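/- Let A be an abelian category, d ≥ 1, and U a d-rigid full additive subcategory of A which is generating (every object is a quotient of an object of U) and such that every object E admits an exact sequence 0 → E → U^1 → ⋯ → U^d → 0 with U^i ∈ U. Then U is closed under d-extensions: every exact sequence 0 → U → E_d → ⋯ → E_1 → U' → 0 with U, U' ∈ U is Yoneda equivalent to an exact sequence 0 → U → V_d → ⋯ → V_1 → U' → 0 with all V_i ∈ U. -/

import Mathlib

open CategoryTheory CategoryTheory.Limits

universe v u

variable (A : Type u) [Category.{v} A] [Abelian A]

/-- An exact sequence `0 → Y → E_n → ⋯ → E_1 → X → 0` with `n` middle terms `E_n, …, E_1`,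
encoded as an `ℕ`-indexed complex with `ob 0 ≅ X`, `ob (n+1) ≅ Y`, zero objects in degrees
above `n+1`, exactness at every position `≥ 1` and an epimorphism at the bottom. -/
structure ExtSeq (n : ℕ) (X Y : A) where
  ob : ℕ → A
  d : ∀ i : ℕ, ob (i + 1) ⟶ ob i
  iso0 : ob 0 ≅ X
  isoTop : ob (n + 1) ≅ Y
  is_zero : ∀ i, n + 1 < i → IsZero (ob i)
  w : ∀ i, d (i + 1) ≫ d i = 0
  ex : ∀ i, (ShortComplex.mk (d (i + 1)) (d i) (w i)).Exact
  epi0 : Epi (d 0)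

variable {A}

/-- A morphism of `n`-extensions inducing the identity on the two end terms. -/
structure ExtSeqHom {n : ℕ} {X Y : A} (s t : ExtSeq A n X Y) where
  φ : ∀ i, s.ob i ⟶ t.ob i
  comm : ∀ i, s.d i ≫ φ i = φ (i + 1) ≫ t.d i
  φ0 : φ 0 = s.iso0.hom ≫ t.iso0.inv
  φTop : φ (n + 1) = s.isoTop.hom ≫ t.isoTop.inv

/-- Yoneda equivalence of `n`-fold extensions: the equivalence relation generated by the
existence of a morphism of extensions fixing the end terms. -/
def YonedaEquiv {n : ℕ} {X Y : A} : ExtSeq A n X Y → ExtSeq A n X Y → Prop :=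
  Relation.EqvGen fun s t => Nonempty (ExtSeqHom s t)

variable (A) in
/-- `extVanish A n X Y` expresses the vanishing of the Yoneda Ext-group `Ext^n_A(X, Y)`:
all `n`-fold extensions of `X` by `Y` are Yoneda equivalent. -/
def extVanish (n : ℕ) (X Y : A) : Prop :=
  ∀ s t : ExtSeq A n X Y, YonedaEquiv s t

variable (A) in
/-- `coresSet 𝒰 j` is the class `𝒰^j(A)` of objects `E` admitting an exact sequence
`0 → E → U^1 → ⋯ → U^j → 0` with all `U^i ∈ 𝒰`. -/
def coresSet (𝒰 : Set A) : ℕ → Set A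
  | 0 => {E | IsZero E}
  | j + 1 => {E | ∃ (V : A) (f : E ⟶ V), V ∈ 𝒰 ∧ Mono f ∧ cokernel f ∈ coresSet 𝒰 j}

variable (A) in
/-- `resSet 𝒰 j` is the class `𝒰_j(A)` of objects `E` admitting an exact sequence
`0 → U_j → ⋯ → U_1 → E → 0` with all `U_i ∈ 𝒰`. -/
def resSet (𝒰 : Set A) : ℕ → Set A
  | 0 => {E | IsZero E}
  | j + 1 => {E | ∃ (V : A) (f : V ⟶ E), V ∈ 𝒰 ∧ Epi f ∧ kernel f ∈ resSet 𝒰 j}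

/-- The extension lies (admissibly) in the subcategory `𝒮`: all its terms and all the
images of its differentials (the splice objects) belong to `𝒮`. -/
def ExtSeq.allIn {n : ℕ} {X Y : A} (s : ExtSeq A n X Y) (𝒮 : Set A) : Prop :=
  (∀ i, i ≤ n + 1 → s.ob i ∈ 𝒮) ∧ ∀ i, 1 ≤ i → i ≤ n → (image (s.d i) : A) ∈ 𝒮

/-- Yoneda equivalence computed inside the subcategory `𝒮`: the equivalence relation
generated by morphisms of extensions between extensions lying in `𝒮`. -/
def YonedaEquivIn (𝒮 : Set A) {n : ℕ} {X Y : A} :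
    ExtSeq A n X Y → ExtSeq A n X Y → Prop :=
  Relation.EqvGen fun s t => s.allIn 𝒮 ∧ t.allIn 𝒮 ∧ Nonempty (ExtSeqHom s t)

variable (A) in
/-- `𝒰` is closed under `d`-extensions in `A`. -/
def DExtClosed (𝒰 : Set A) (d : ℕ) : Prop :=
  ∀ (X Y : A), X ∈ 𝒰 → Y ∈ 𝒰 → ∀ s : ExtSeq A d X Y,
    ∃ t : ExtSeq A d X Y, (∀ i, 1 ≤ i → i ≤ d → t.ob i ∈ 𝒰) ∧ YonedaEquiv s t


section Efface
open HomologicalComplex Abelian Category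

variable {C : Type u} [Category.{v} C] [Abelian C]

lemma aux_epi {X : C} {K : CochainComplex C ℤ}
    (π : K ⟶ (HomologicalComplex.single C (ComplexShape.up ℤ) 0).obj X) [K.IsStrictlyLE 0] [QuasiIsoAt π 0] :
    Epi (π.f 0 ≫ (singleObjXSelf (ComplexShape.up ℤ) 0 X).hom) := by
  let e := K.iCyclesIso 0 (0 + 1) (by simp)
    ((K.isZero_of_isStrictlyLE 0 (0 + 1) (by simp)).eq_of_tgt _ _)
  let α := e.inv ≫ K.homologyπ 0 ≫ homologyMap π 0 ≫ (singleObjHomologySelfIso _ _ _).hom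
  have : π.f 0 = α ≫ (singleObjXSelf (ComplexShape.up ℤ) 0 X).inv := by
    rw [← cancel_epi e.hom]
    dsimp [α, e]
    rw [assoc, assoc, assoc, Iso.hom_inv_id_assoc, iCyclesIso_hom,
      homologyπ_naturality_assoc]
    rw [homologyπ_singleObjHomologySelfIso_hom_assoc,
      ← singleObjCyclesSelfIso_inv_iCycles, Iso.hom_inv_id_assoc, ← cyclesMap_i]
  rw [this, assoc, Iso.inv_hom_id, comp_id]
  dsimp only [α]
  have : Epi (K.homologyπ 0) := inferInstance
  infer_instance

open DerivedCategory in
lemma aux_efface [HasDerivedCategory.{w} C] {X : C}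
    {L : CochainComplex C ℤ}
    (φ : Q.obj ((HomologicalComplex.single C (ComplexShape.up ℤ) 0).obj X) ⟶ Q.obj L)
    (n : ℤ) (hn : n < 0) [L.IsStrictlyLE n] :
    ∃ (P : C) (p : P ⟶ X), Epi p ∧
      Q.map ((HomologicalComplex.single C (ComplexShape.up ℤ) 0).map p) ≫ φ = 0 := by
  obtain ⟨K, _, π, h, g, rfl⟩ := right_fac_of_isStrictlyLE φ 0
  have h' := h
  rw [isIso_Q_map_iff_quasiIso] at h'
  let s : (HomologicalComplex.single C (ComplexShape.up ℤ) 0).obj (K.X 0) ⟶ K :=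
    mkHomFromSingle (𝟙 _) (by
      rintro _ rfl
      apply (K.isZero_of_isStrictlyLE 0 (0 + 1) (by simp)).eq_of_tgt)
  refine ⟨K.X 0, _, aux_epi π, ?_⟩
  have h1 : (HomologicalComplex.single C (ComplexShape.up ℤ) 0).map
      (π.f 0 ≫ (singleObjXSelf (ComplexShape.up ℤ) 0 X).hom) = s ≫ π := by
    apply HomologicalComplex.from_single_hom_ext
    simp [s, mkHomFromSingle_f, single_map_f_self]
  have h2 : s ≫ g = 0 := by
    apply HomologicalComplex.from_single_hom_ext
    apply (L.isZero_of_isStrictlyLE n 0 hn).eq_of_tgt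
  rw [h1, Q.map_comp, assoc, IsIso.hom_inv_id_assoc, ← Q.map_comp, h2, Q.map_zero]

open DerivedCategory in
lemma ext_efface [HasExt.{w} C] {X Y : C} {n : ℕ} (e : Ext X Y (n + 1)) :
    ∃ (P : C) (p : P ⟶ X), Epi p ∧ (Ext.mk₀ p).comp e (zero_add _) = 0 := by
  let := HasDerivedCategory.standard C
  obtain ⟨P, p, hp, h⟩ := aux_efface (X := X) (L := (CochainComplex.singleFunctor C (-(n + 1))).obj Y)
    (e.hom ≫ (((singleFunctors C).shiftIso (n + 1) (-(n + 1)) 0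
    (by lia)).hom.app _)) (-(n+1)) (by lia)
  refine ⟨P, p, hp, ?_⟩
  apply Ext.homEquiv.injective
  rw [← cancel_mono (((singleFunctors C).shiftIso (n + 1) (-(n + 1)) 0
    (by lia)).hom.app _)]
  have := Ext.singleFunctor_map_comp_hom p e
  change Ext.hom _ ≫ _ = Ext.hom _ ≫ _
  erw [← this, Ext.zero_hom, Limits.zero_comp, assoc]
  exact h
end Efface

section Exactness
variable {X' X Y Z Z' : A}

lemma ex_mono_iff (f : X ⟶ Y) (g : Y ⟶ Z) (m : Z ⟶ Z') [Mono m] (w : f ≫ g = 0)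
    (w' : f ≫ g ≫ m = 0) :
    (ShortComplex.mk f (g ≫ m) w').Exact ↔ (ShortComplex.mk f g w).Exact := by
  let φ : ShortComplex.mk f g w ⟶ ShortComplex.mk f (g ≫ m) w' :=
    { τ₁ := 𝟙 _, τ₂ := 𝟙 _, τ₃ := m }
  have : Epi φ.τ₁ := by dsimp [φ]; infer_instance
  have : IsIso φ.τ₂ := by dsimp [φ]; infer_instance
  have : Mono φ.τ₃ := by dsimp [φ]; infer_instance
  exact (ShortComplex.exact_iff_of_epi_of_isIso_of_mono φ).symm

lemma ex_epi_iff (e : X' ⟶ X) [Epi e] (f : X ⟶ Y) (g : Y ⟶ Z) (w : f ≫ g = 0)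
    (w' : (e ≫ f) ≫ g = 0) :
    (ShortComplex.mk (e ≫ f) g w').Exact ↔ (ShortComplex.mk f g w).Exact := by
  let φ : ShortComplex.mk (e ≫ f) g w' ⟶ ShortComplex.mk f g w :=
    { τ₁ := e, τ₂ := 𝟙 _, τ₃ := 𝟙 _ }
  have : Epi φ.τ₁ := by dsimp [φ]; infer_instance
  have : IsIso φ.τ₂ := by dsimp [φ]; infer_instance
  have : Mono φ.τ₃ := by dsimp [φ]; infer_instance
  exact (ShortComplex.exact_iff_of_epi_of_isIso_of_mono φ)

end Exactness

namespace ExtSeq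

/-- A morphism of extensions over a morphism `a` at the right end, the identity at the left. -/
structure GHom {n : ℕ} {X X' Y : A} (s : ExtSeq A n X Y) (t : ExtSeq A n X' Y)
    (a : X ⟶ X') where
  φ : ∀ i, s.ob i ⟶ t.ob i
  comm : ∀ i, s.d i ≫ φ i = φ (i + 1) ≫ t.d i
  φ0 : φ 0 ≫ t.iso0.hom = s.iso0.hom ≫ a
  φTop : φ (n + 1) ≫ t.isoTop.hom = s.isoTop.hom

variable {n : ℕ} {X X' Y : A}

def GHom.ofHom {s t : ExtSeq A n X Y} (f : ExtSeqHom s t) : GHom s t (𝟙 X) where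
  φ := f.φ
  comm := f.comm
  φ0 := by simp [f.φ0]
  φTop := by simp [f.φTop]

def GHom.toHom {s t : ExtSeq A n X Y} (f : GHom s t (𝟙 X)) : ExtSeqHom s t where
  φ := f.φ
  comm := f.comm
  φ0 := by rw [Iso.eq_comp_inv, f.φ0, Category.comp_id]
  φTop := by rw [Iso.eq_comp_inv, f.φTop]

def GHom.comp {X₂ : A} {s : ExtSeq A n X Y} {t : ExtSeq A n X' Y} {r : ExtSeq A n X₂ Y}
    {a : X ⟶ X'} {b : X' ⟶ X₂} (f : GHom s t a) (g : GHom t r b) : GHom s r (a ≫ b) where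
  φ i := f.φ i ≫ g.φ i
  comm i := by rw [← Category.assoc, f.comm, Category.assoc, g.comm, Category.assoc]
  φ0 := by rw [Category.assoc, g.φ0, ← Category.assoc, f.φ0, Category.assoc]
  φTop := by rw [Category.assoc, g.φTop, f.φTop]

/-! ### The right end of an extension -/

/-- The last map of an extension. -/
abbrev p (s : ExtSeq A n X Y) : s.ob 1 ⟶ X := s.d 0 ≫ s.iso0.hom

instance (s : ExtSeq A n X Y) : Epi s.p := by
  have := s.epi0
  dsimp [p]; infer_instance

noncomputable abbrev rightSC (s : ExtSeq A n X Y) : ShortComplex A :=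
  ShortComplex.mk (kernel.ι s.p) s.p (kernel.condition _)

lemma rightSC_shortExact (s : ExtSeq A n X Y) : s.rightSC.ShortExact where
  exact := ShortComplex.exact_kernel _

noncomputable def tailOb (s : ExtSeq A n X Y) : ℕ → A
  | 0 => kernel s.p
  | i + 1 => s.ob (i + 2)

lemma d_p (s : ExtSeq A n X Y) : s.d 1 ≫ s.p = 0 := by
  rw [← Category.assoc, s.w, zero_comp]

noncomputable def tailD (s : ExtSeq A n X Y) : ∀ i, s.tailOb (i + 1) ⟶ s.tailOb i
  | 0 => kernel.lift s.p (s.d 1) s.d_p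
  | i + 1 => s.d (i + 2)

lemma exact_d_p (s : ExtSeq A n X Y) : (ShortComplex.mk (s.d 1) s.p s.d_p).Exact :=
  (ex_mono_iff _ _ _ (s.w 0) _).2 (s.ex 0)

noncomputable def tail (s : ExtSeq A (n + 1) X Y) : ExtSeq A n (kernel s.p) Y where
  ob := s.tailOb
  d := s.tailD
  iso0 := Iso.refl _
  isoTop := s.isoTop
  is_zero := by
    rintro (_ | i) hi
    · omega
    · exact s.is_zero _ (by omega)
  w := by
    rintro (_ | i)
    · change s.d 2 ≫ kernel.lift s.p (s.d 1) s.d_p = 0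
      rw [← cancel_mono (kernel.ι s.p)]
      simp [s.w 1]
    · exact s.w _
  ex := by
    rintro (_ | i)
    · refine (ex_mono_iff (s.d 2) (kernel.lift s.p (s.d 1) s.d_p) (kernel.ι s.p) _ ?_).1 ?_
      · simp [s.w 1]
      · simpa using s.ex 1
    · exact s.ex _
  epi0 := s.exact_d_p.epi_kernelLift

noncomputable def tailHom {s : ExtSeq A (n + 1) X Y} {t : ExtSeq A (n + 1) X' Y} {a : X ⟶ X'}
    (f : GHom s t a) : GHom s.tail t.tail
      (kernel.map s.p t.p (f.φ 1) a (by
        rw [Category.assoc, ← f.φ0, ← Category.assoc, ← Category.assoc, f.comm])) where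
  φ
    | 0 => (kernel.map s.p t.p (f.φ 1) a (by
        rw [Category.assoc, ← f.φ0, ← Category.assoc, ← Category.assoc, f.comm]))
    | i + 1 => f.φ (i + 2)
  comm := by
    rintro (_ | i)
    · change kernel.lift s.p (s.d 1) s.d_p ≫ kernel.map _ _ _ _ _ =
        f.φ 2 ≫ kernel.lift t.p (t.d 1) t.d_p
      rw [← cancel_mono (kernel.ι t.p)]
      simp [f.comm 1]
    · exact f.comm _
  φ0 := by
    change kernel.map _ _ _ _ _ ≫ 𝟙 _ = 𝟙 _ ≫ _
    rw [Category.comp_id, Category.id_comp]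
  φTop := f.φTop

/-! ### Splicing -/

section splice

variable (S : ShortComplex A) (hS : S.ShortExact)

def spliceOb (ob : ℕ → A) : ℕ → A
  | 0 => S.X₃
  | 1 => S.X₂
  | i + 2 => ob (i + 1)

def spliceD (t : ExtSeq A n S.X₁ Y) : ∀ i, spliceOb S t.ob (i + 1) ⟶ spliceOb S t.ob i
  | 0 => S.g
  | 1 => t.p ≫ S.f
  | i + 2 => t.d (i + 1)

variable {S}

def splice (t : ExtSeq A n S.X₁ Y) : ExtSeq A (n + 1) S.X₃ Y where
  ob := spliceOb S t.ob
  d := spliceD S t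
  iso0 := Iso.refl _
  isoTop := t.isoTop
  is_zero := by
    rintro (_ | _ | i) hi
    · omega
    · omega
    · exact t.is_zero _ (by omega)
  w := by
    rintro (_ | _ | i)
    · change (t.p ≫ S.f) ≫ S.g = 0
      simp
    · change t.d 1 ≫ t.p ≫ S.f = 0
      rw [← Category.assoc, d_p, zero_comp]
    · exact t.w _
  ex := by
    rintro (_ | _ | i)
    · exact (ex_epi_iff t.p S.f S.g S.zero _).2 hS.exact
    · have := hS.mono_f
      exact (ex_mono_iff (t.d 1) t.p S.f t.d_p _).2 t.exact_d_p
    · exact t.ex _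
  epi0 := hS.epi_g

variable {S' : ShortComplex A} (hS' : S'.ShortExact)

def spliceHom {t : ExtSeq A n S.X₁ Y} {t' : ExtSeq A n S'.X₁ Y} (f : S ⟶ S')
    (g : GHom t t' f.τ₁) : GHom (splice hS t) (splice hS' t') f.τ₃ where
  φ
    | 0 => f.τ₃
    | 1 => f.τ₂
    | i + 2 => g.φ (i + 1)
  comm := by
    rintro (_ | _ | i)
    · exact f.comm₂₃.symm
    · change (t.p ≫ S.f) ≫ f.τ₂ = g.φ 1 ≫ t'.p ≫ S'.f
      rw [Category.assoc, ← f.comm₁₂, Category.assoc, ← Category.assoc t.iso0.hom, ← g.φ0]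
      simp only [← Category.assoc]
      rw [g.comm]
    · exact g.comm _
  φ0 := by
    change f.τ₃ ≫ 𝟙 _ = 𝟙 _ ≫ f.τ₃
    simp
  φTop := g.φTop

noncomputable def toSplice (s : ExtSeq A (n + 1) X Y) :
    GHom s (splice s.rightSC_shortExact s.tail) (𝟙 X) where
  φ
    | 0 => s.iso0.hom
    | 1 => 𝟙 _
    | i + 2 => 𝟙 _
  comm := by
    rintro (_ | _ | i)
    · change s.p = 𝟙 _ ≫ s.p
      simp
    · change s.d 1 ≫ 𝟙 _ = 𝟙 _ ≫ (kernel.lift s.p (s.d 1) s.d_p ≫ 𝟙 _) ≫ kernel.ι _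
      simp
    · change s.d _ ≫ 𝟙 _ = 𝟙 _ ≫ s.d _
      simp
  φ0 := rfl
  φTop := Category.id_comp _

noncomputable def fromSplice (s : ExtSeq A (n + 1) X Y) :
    GHom (splice s.rightSC_shortExact s.tail) s (𝟙 X) where
  φ
    | 0 => s.iso0.inv
    | 1 => 𝟙 _
    | i + 2 => 𝟙 _
  comm := by
    rintro (_ | _ | i)
    · change s.p ≫ _ = 𝟙 _ ≫ s.d 0
      simp
    · change ((kernel.lift s.p (s.d 1) s.d_p ≫ 𝟙 _) ≫ kernel.ι _) ≫ 𝟙 _ = 𝟙 _ ≫ s.d 1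
      simp
    · change s.d _ ≫ 𝟙 _ = 𝟙 _ ≫ s.d _
      simp
  φ0 := by
    change s.iso0.inv ≫ s.iso0.hom = 𝟙 _ ≫ 𝟙 _
    simp
  φTop := Category.id_comp _

lemma splice_p (t : ExtSeq A n S.X₁ Y) : (splice hS t).p = (S.g : S.X₂ ⟶ S.X₃) :=
  Category.comp_id S.g

/-- The inclusion of the kernel of the last map of a splice. -/
noncomputable def spliceι (t : ExtSeq A n S.X₁ Y) : kernel (splice hS t).p ⟶ S.X₂ :=
  kernel.ι (splice hS t).p

lemma spliceι_g (t : ExtSeq A n S.X₁ Y) : spliceι hS t ≫ S.g = 0 :=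
  (congrArg (spliceι hS t ≫ ·) (splice_p hS t)).symm.trans (kernel.condition (splice hS t).p)

/-- The kernel of the last map of a splice is the expected one. -/
noncomputable def kerSplice (t : ExtSeq A n S.X₁ Y) : kernel (splice hS t).p ⟶ S.X₁ :=
  have := hS.mono_f
  hS.exact.lift (spliceι hS t) (spliceι_g hS t)

lemma kerSplice_f (t : ExtSeq A n S.X₁ Y) :
    kerSplice hS t ≫ S.f = spliceι hS t := by
  have := hS.mono_f
  exact hS.exact.lift_f _ _

lemma kerSplice_lift (t : ExtSeq A n S.X₁ Y) (l : t.ob 1 ⟶ kernel (splice hS t).p)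
    (hl : l ≫ spliceι hS t = t.p ≫ S.f) :
    l ≫ kerSplice hS t ≫ t.iso0.inv = 𝟙 _ ≫ t.d 0 := by
  have := hS.mono_f
  have h : l ≫ kerSplice hS t = t.p := by
    rw [← cancel_mono S.f, Category.assoc, kerSplice_f, hl]
  rw [← Category.assoc, h]
  simp

noncomputable def tailSplice (t : ExtSeq A n S.X₁ Y) :
    GHom (splice hS t).tail t (kerSplice hS t) where
  φ
    | 0 => kerSplice hS t ≫ t.iso0.inv
    | i + 1 => 𝟙 _
  comm := by
    rintro (_ | i)
    · exact kerSplice_lift hS t _ (kernel.lift_ι (splice hS t).p _ (splice hS t).d_p)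
    · change t.d _ ≫ 𝟙 _ = 𝟙 _ ≫ t.d _
      simp
  φ0 := by
    change (kerSplice hS t ≫ t.iso0.inv) ≫ t.iso0.hom = 𝟙 _ ≫ _
    simp
  φTop := Category.id_comp _

end splice

end ExtSeq

/-! ### The class of an extension in Mathlib's `Ext` -/

namespace ExtSeq

open Abelian

universe w

lemma isIso_p {X Y : A} (s : ExtSeq A 0 X Y) : IsIso s.p := by
  have : Mono s.p := s.exact_d_p.mono_g ((s.is_zero 2 (by omega)).eq_of_src _ _)
  exact isIso_of_mono_of_epi _

lemma pushout_shortExact {P X Y : A} (p : P ⟶ X) [Epi p] (b : kernel p ⟶ Y) :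
    ∃ (E : A) (i : Y ⟶ E) (q : E ⟶ X) (w : i ≫ q = 0) (l : P ⟶ E),
      (ShortComplex.mk i q w).ShortExact ∧ b ≫ i = kernel.ι p ≫ l ∧ l ≫ q = p := by
  have hb : kernel.ι p ≫ p = b ≫ (0 : Y ⟶ X) := by rw [kernel.condition, comp_zero]
  have hS : (ShortComplex.mk (kernel.ι p) p (kernel.condition p)).Exact :=
    ShortComplex.exact_kernel p
  have w : pushout.inr (kernel.ι p) b ≫ pushout.desc p 0 hb = 0 := pushout.inr_desc _ _ _
  have h1 : pushout.inl (kernel.ι p) b ≫ pushout.desc p 0 hb = p := pushout.inl_desc _ _ _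
  have : Epi (pushout.desc p 0 hb) := by
    have : Epi (pushout.inl (kernel.ι p) b ≫ pushout.desc p 0 hb) := by rw [h1]; infer_instance
    exact epi_of_epi (pushout.inl (kernel.ι p) b) _
  have hm : Mono (pushout.inr (kernel.ι p) b) := inferInstance
  refine ⟨_, _, _, w, _, ?_, pushout.condition.symm, h1⟩
  exact
    { exact := by
        refine ShortComplex.exact_of_g_is_cokernel _ (CokernelCofork.IsColimit.ofπ' _ _ ?_)
        intro Z k hk
        have hk' : kernel.ι p ≫ pushout.inl (kernel.ι p) b ≫ k = 0 := by
          rw [← Category.assoc, pushout.condition, Category.assoc]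
          refine Eq.trans (congrArg (b ≫ ·) hk) comp_zero
        have hg : Epi p := inferInstance
        refine ⟨hS.desc (pushout.inl (kernel.ι p) b ≫ k) hk', ?_⟩
        have h3 : p ≫ hS.desc (pushout.inl (kernel.ι p) b ≫ k) hk' =
          pushout.inl (kernel.ι p) b ≫ k := hS.g_desc _ hk'
        apply pushout.hom_ext
        · dsimp only
          rw [← Category.assoc, h1, h3]
        · dsimp only
          rw [← Category.assoc, w, zero_comp]
          exact hk.symm
      mono_f := hm
      epi_g := this }

variable [HasExt.{w} A]

/-- The class of an extension. -/
noncomputable def cls : ∀ {n : ℕ} {X Y : A}, ExtSeq A n X Y → Ext.{w} X Y n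
  | 0, _, _, s => Ext.mk₀ ((@inv _ _ _ _ s.p s.isIso_p) ≫ s.isoTop.hom)
  | n + 1, _, _, s => s.rightSC_shortExact.extClass.comp (cls s.tail) (by omega)

lemma cls_naturality {n : ℕ} {X X' Y : A} {s : ExtSeq A n X Y} {t : ExtSeq A n X' Y}
    {a : X ⟶ X'} (f : GHom s t a) :
    cls.{v, u, w} s = (Ext.mk₀ a).comp (cls.{v, u, w} t) (zero_add n) := by
  induction n generalizing X X' with
  | zero =>
    have := s.isIso_p
    have := t.isIso_p
    simp only [cls, Ext.mk₀_comp_mk₀]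
    congr 1
    have h : f.φ 1 ≫ t.p = s.p ≫ a := by
      rw [← Category.assoc, ← f.comm, Category.assoc, Category.assoc, f.φ0]
    rw [IsIso.inv_comp_eq, ← f.φTop]
    have h' : s.p ≫ a ≫ inv t.p = f.φ 1 := by
      rw [← Category.assoc, IsIso.comp_inv_eq, h]
    have h2 : f.φ 1 ≫ t.isoTop.hom = (s.p ≫ a ≫ inv t.p) ≫ t.isoTop.hom := by rw [h']
    refine h2.trans ?_
    exact (Category.assoc _ _ _).trans (congrArg _ (Category.assoc _ _ _))
  | succ n ih =>
    have h := ih (tailHom f)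
    let φ : s.rightSC ⟶ t.rightSC :=
      { τ₁ := kernel.map s.p t.p (f.φ 1) a (by
          rw [Category.assoc, ← f.φ0, ← Category.assoc, ← Category.assoc, f.comm])
        τ₂ := f.φ 1
        τ₃ := a
        comm₁₂ := by simp
        comm₂₃ := by
          dsimp
          rw [Category.assoc, ← f.φ0, ← Category.assoc, ← Category.assoc, f.comm] }
    have h2 := ShortComplex.ShortExact.extClass_naturality s.rightSC_shortExact
      t.rightSC_shortExact φ
    simp only [cls]
    rw [h, ← Ext.comp_assoc_of_second_deg_zero]
    erw [h2]
    rw [Ext.comp_assoc]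
    omega

lemma cls_splice {n : ℕ} {Y : A} {S : ShortComplex A} (hS : S.ShortExact)
    (t : ExtSeq A n S.X₁ Y) :
    cls.{v, u, w} (splice hS t) = hS.extClass.comp (cls.{v, u, w} t) (add_comm 1 n) := by
  have h := cls_naturality (tailSplice hS t)
  simp only [cls]
  let φ : (splice hS t).rightSC ⟶ S :=
    { τ₁ := kerSplice hS t
      τ₂ := 𝟙 S.X₂
      τ₃ := 𝟙 S.X₃
      comm₁₂ := (kerSplice_f hS t).trans (Category.comp_id _).symm
      comm₂₃ := by
        refine (Category.id_comp S.g).trans ?_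
        exact ((Category.comp_id _).trans (splice_p hS t)).symm }
  have h2 := ShortComplex.ShortExact.extClass_naturality (splice hS t).rightSC_shortExact
      hS φ
  rw [h, ← Ext.comp_assoc_of_second_deg_zero]
  erw [h2]
  congr 1
  exact Ext.mk₀_id_comp _

lemma cls_eq_of_yonedaEquiv {n : ℕ} {X Y : A} {s t : ExtSeq A n X Y} (h : YonedaEquiv s t) :
    cls.{v, u, w} s = cls.{v, u, w} t := by
  induction h with
  | rel s t h =>
    obtain ⟨f⟩ := h
    simpa using cls_naturality (GHom.ofHom f)
  | refl => rfl
  | symm _ _ _ ih => exact ih.symm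
  | trans _ _ _ _ _ h1 h2 => exact h1.trans h2

/-- A zero-fold extension. -/
noncomputable def triv (Y : A) : ExtSeq A 0 Y Y where
  ob
    | 0 => Y
    | 1 => Y
    | _ + 2 => (HasZeroObject.zero' A).zero
  d
    | 0 => 𝟙 Y
    | _ + 1 => 0
  iso0 := Iso.refl _
  isoTop := Iso.refl _
  is_zero := by
    rintro (_ | _ | i) hi
    · omega
    · omega
    · exact isZero_zero A
  w := by
    rintro (_ | i)
    · exact zero_comp
    · exact comp_zero
  ex := by
    rintro (_ | i)
    · refine (ShortComplex.exact_iff_mono _ rfl).2 ?_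
      change Mono (𝟙 Y)
      infer_instance
    · exact ShortComplex.exact_of_isZero_X₂ _ (isZero_zero A)
  epi0 := by
    change Epi (𝟙 Y)
    infer_instance

lemma cls_triv (Y : A) : cls.{v, u, w} (triv Y) = Ext.mk₀ (𝟙 Y) := by
  have := (triv Y).isIso_p
  simp only [cls]
  congr 1
  rw [IsIso.inv_comp_eq]
  change 𝟙 Y = (𝟙 Y ≫ 𝟙 Y) ≫ 𝟙 Y
  simp

lemma exists_shortExact {X Y : A} (α : Ext.{w} X Y 1) :
    ∃ (E : A) (i : Y ⟶ E) (p : E ⟶ X) (w : i ≫ p = 0)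
      (h : (ShortComplex.mk i p w).ShortExact), h.extClass = α := by
  obtain ⟨P, p, hp, h⟩ := ext_efface α
  let S := ShortComplex.mk (kernel.ι p) p (kernel.condition p)
  have hS : S.ShortExact := { exact := ShortComplex.exact_kernel p }
  obtain ⟨β, hβ⟩ := Ext.contravariant_sequence_exact₃ hS Y α h (n₀ := 0) rfl
  obtain ⟨b, rfl⟩ := (Ext.mk₀_bijective _ _).2 β
  obtain ⟨E, i, q, w, l, hE, h1, h2⟩ := pushout_shortExact p b
  refine ⟨_, _, _, w, hE, ?_⟩
  let φ : S ⟶ ShortComplex.mk _ _ w :=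
    { τ₁ := b
      τ₂ := l
      τ₃ := 𝟙 X
      comm₁₂ := h1
      comm₂₃ := h2.trans (Category.comp_id p).symm }
  have h2 := ShortComplex.ShortExact.extClass_naturality hS hE φ
  rw [← hβ]
  refine Eq.trans ?_ h2.symm
  exact (Ext.mk₀_id_comp _).symm

lemma exists_cls_eq {n : ℕ} {X Y : A} (α : Ext.{w} X Y (n + 1)) :
    ∃ s : ExtSeq A (n + 1) X Y, cls.{v, u, w} s = α := by
  induction n generalizing X with
  | zero =>
    obtain ⟨E, i, p, w, h, rfl⟩ := exists_shortExact α
    refine ⟨splice h (triv Y), ?_⟩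
    rw [cls_splice, cls_triv]
    exact Ext.comp_mk₀_id _
  | succ n ih =>
    obtain ⟨P, p, hp, h⟩ := ext_efface α
    let S := ShortComplex.mk (kernel.ι p) p (kernel.condition p)
    have hS : S.ShortExact := { exact := ShortComplex.exact_kernel p }
    obtain ⟨β, hβ⟩ := Ext.contravariant_sequence_exact₃ hS Y α h (n₀ := n + 1) (by omega)
    obtain ⟨t, rfl⟩ := ih β
    exact ⟨splice hS t, (cls_splice hS t).trans hβ⟩

lemma subsingleton_ext_of_extVanish {n : ℕ} {X Y : A} (h : extVanish A (n + 1) X Y) :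
    Subsingleton (Ext.{w} X Y (n + 1)) where
  allEq a b := by
    obtain ⟨s, rfl⟩ := exists_cls_eq a
    obtain ⟨t, rfl⟩ := exists_cls_eq b
    exact cls_eq_of_yonedaEquiv (h s t)

end ExtSeq

/-! ### Vanishing of `Ext` out of objects with coresolutions -/

section Vanishing

open Abelian

universe w

lemma cokernel_shortExact {X Y : A} (f : X ⟶ Y) [Mono f] :
    (ShortComplex.mk f (cokernel.π f) (cokernel.condition f)).ShortExact :=
  { exact := ShortComplex.exact_cokernel f }

variable [HasExt.{w} A]

lemma cores_ext_subsingleton {d : ℕ} {𝒰 : Set A}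
    (hrigid : ∀ i, 0 < i → i < d → ∀ U ∈ 𝒰, ∀ U' ∈ 𝒰, extVanish A i U U')
    {W : A} (hW : W ∈ 𝒰) (k : ℕ) : ∀ (M : A), M ∈ coresSet A 𝒰 k → ∀ i : ℕ,
    i + 1 + k ≤ d → Subsingleton (Ext.{w} M W (i + 1)) := by
  induction k with
  | zero =>
    intro M hM i hi
    have hM : IsZero M := hM
    refine ⟨fun a b => ?_⟩
    rw [← Ext.mk₀_id_comp a, ← Ext.mk₀_id_comp b, hM.eq_of_src (𝟙 M) 0, Ext.mk₀_zero,
      Ext.zero_comp, Ext.zero_comp]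
  | succ k ih =>
    rintro M ⟨V, f, hV, hf, hC⟩ i hi
    have h1 := ih _ hC (i + 1) (by omega)
    have h2 : Subsingleton (Ext.{w} V W (i + 1)) :=
      ExtSeq.subsingleton_ext_of_extVanish (hrigid _ (by omega) (by omega) V hV W hW)
    have key : ∀ a : Ext.{w} M W (i + 1), a = 0 := by
      intro a
      obtain ⟨b, hb⟩ := Ext.contravariant_sequence_exact₁ (cokernel_shortExact f) W a
        (n₁ := i + 2) (by omega) (h1.allEq _ _)
      rw [← hb, h2.allEq b 0]
      exact Ext.comp_zero ..
    exact ⟨fun a b => (key a).trans (key b).symm⟩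

lemma cores_extend_aux {d : ℕ} {𝒰 : Set A}
    (hrigid : ∀ i, 0 < i → i < d → ∀ U ∈ 𝒰, ∀ U' ∈ 𝒰, extVanish A i U U')
    {W : A} (hW : W ∈ 𝒰) (k : ℕ) {M V : A} (f : M ⟶ V) [Mono f]
    (hC : cokernel f ∈ coresSet A 𝒰 k) (hk : k + 1 ≤ d) (g : M ⟶ W) :
    ∃ e : V ⟶ W, f ≫ e = g := by
  have h1 := cores_ext_subsingleton.{v, u, w} hrigid hW k _ hC 0 (by omega)
  obtain ⟨b, hb⟩ := Ext.contravariant_sequence_exact₁ (cokernel_shortExact f) W (Ext.mk₀ g)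
    (n₁ := 1) (by omega) (h1.allEq _ _)
  obtain ⟨e, rfl⟩ := (Ext.mk₀_bijective _ _).2 b
  refine ⟨e, (Ext.mk₀_bijective _ _).1 ?_⟩
  rw [← hb]
  simp

end Vanishing

lemma cores_extend {d : ℕ} {𝒰 : Set A}
    (hrigid : ∀ i, 0 < i → i < d → ∀ U ∈ 𝒰, ∀ U' ∈ 𝒰, extVanish A i U U')
    {W : A} (hW : W ∈ 𝒰) (k : ℕ) {M V : A} (f : M ⟶ V) [Mono f]
    (hC : cokernel f ∈ coresSet A 𝒰 k) (hk : k + 1 ≤ d) (g : M ⟶ W) :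
    ∃ e : V ⟶ W, f ≫ e = g := by
  have := HasExt.standard A
  exact cores_extend_aux hrigid hW k f hC hk g

lemma coresSet_iso {𝒰 : Set A} {k : ℕ} {M N : A} (e : M ≅ N) (h : M ∈ coresSet A 𝒰 k) :
    N ∈ coresSet A 𝒰 k := by
  induction k generalizing M N with
  | zero => exact IsZero.of_iso h e.symm
  | succ k ih =>
    obtain ⟨V, f, hV, hf, hC⟩ := h
    exact ⟨V, e.inv ≫ f, hV, inferInstance, ih (cokernelEpiComp e.inv f).symm hC⟩

lemma coresSet_biprod {𝒰 : Set A} (hUadd : ∀ X Y : A, X ∈ 𝒰 → Y ∈ 𝒰 → (X ⊞ Y) ∈ 𝒰)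
    {k : ℕ} {V C : A} (hV : V ∈ 𝒰) (h : C ∈ coresSet A 𝒰 (k + 1)) :
    (V ⊞ C) ∈ coresSet A 𝒰 (k + 1) := by
  obtain ⟨W, f, hW, hf, hC⟩ := h
  refine ⟨V ⊞ W, biprod.map (𝟙 V) f, hUadd _ _ hV hW, inferInstance, coresSet_iso ?_ hC⟩
  refine ⟨cokernel.desc f (biprod.inr ≫ cokernel.π (biprod.map (𝟙 V) f)) ?_,
    cokernel.desc _ (biprod.snd ≫ cokernel.π f) ?_, ?_, ?_⟩
  · rw [← Category.assoc]
    have : f ≫ (biprod.inr : W ⟶ V ⊞ W) = biprod.inr ≫ biprod.map (𝟙 V) f := by simp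
    rw [this, Category.assoc, cokernel.condition, comp_zero]
  · simp
  · rw [← cancel_epi (cokernel.π f)]
    simp
  · rw [← cancel_epi (cokernel.π (biprod.map (𝟙 V) f))]
    have h0 : (biprod.inl : V ⟶ V ⊞ W) ≫ cokernel.π (biprod.map (𝟙 V) f) = 0 := by
      have : (biprod.inl : V ⟶ V ⊞ W) = biprod.inl ≫ biprod.map (𝟙 V) f := by simp
      rw [this, Category.assoc, cokernel.condition, comp_zero]
    apply biprod.hom_ext'
    · simp [h0]
    · simp

lemma mem_of_coresSet_one {𝒰 : Set A} (hUiso : ∀ X Y : A, (X ≅ Y) → X ∈ 𝒰 → Y ∈ 𝒰)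
    {M : A} (h : M ∈ coresSet A 𝒰 1) : M ∈ 𝒰 := by
  obtain ⟨V, f, hV, hf, hC⟩ := h
  have hC : IsZero (cokernel f) := hC
  have : Epi f := Preadditive.epi_of_cokernel_zero (hC.eq_of_tgt _ _)
  have : IsIso f := isIso_of_mono_of_epi f
  exact hUiso _ _ (asIso f).symm hV

/-! ### Replacing the middle terms by objects of the generating subcategory -/

section Refine

variable {E₄ E₃ E₂ E₁ E₀ V : A}

lemma plift_fst {T : A} {f : E₂ ⟶ E₁} {q : V ⟶ E₁} (a : T ⟶ E₂) (b : T ⟶ V)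
    (h : a ≫ f = b ≫ q) : pullback.lift a b h ≫ pullback.fst f q = a :=
  pullback.lift_fst _ _ _

lemma plift_snd {T : A} {f : E₂ ⟶ E₁} {q : V ⟶ E₁} (a : T ⟶ E₂) (b : T ⟶ V)
    (h : a ≫ f = b ≫ q) : pullback.lift a b h ≫ pullback.snd f q = b :=
  pullback.lift_snd _ _ _

lemma exact_refine {d₁ : E₂ ⟶ E₁} {d₀ : E₁ ⟶ E₀} {w : d₁ ≫ d₀ = 0}
    (h : (ShortComplex.mk d₁ d₀ w).Exact) {T : A} (x : T ⟶ E₁) (hx : x ≫ d₀ = 0) :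
    ∃ (T' : A) (π : T' ⟶ T) (_ : Epi π) (y : T' ⟶ E₂), π ≫ x = y ≫ d₁ :=
  h.exact_up_to_refinements x hx

lemma exact_of_refine {d₁ : E₂ ⟶ E₁} {d₀ : E₁ ⟶ E₀} (w : d₁ ≫ d₀ = 0)
    (h : ∀ {T : A} (x : T ⟶ E₁) (_ : x ≫ d₀ = 0),
    ∃ (T' : A) (π : T' ⟶ T) (_ : Epi π) (y : T' ⟶ E₂), π ≫ x = y ≫ d₁) :
    (ShortComplex.mk d₁ d₀ w).Exact :=
  (ShortComplex.exact_iff_exact_up_to_refinements _).2 fun _ x hx => h x hx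

lemma pull_exact₁ {d₁ : E₂ ⟶ E₁} {d₀ : E₁ ⟶ E₀} {w : d₁ ≫ d₀ = 0}
    (h : (ShortComplex.mk d₁ d₀ w).Exact) (q : V ⟶ E₁)
    (w' : pullback.snd d₁ q ≫ q ≫ d₀ = 0) :
    (ShortComplex.mk (pullback.snd d₁ q) (q ≫ d₀) w').Exact := by
  refine exact_of_refine _ fun x hx => ?_
  obtain ⟨T', π, hπ, y, hy⟩ := exact_refine h (x ≫ q) (by simpa using hx)
  exact ⟨T', π, hπ, pullback.lift y (π ≫ x) (by rw [← hy, Category.assoc]),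
    (plift_snd _ _ _).symm⟩

lemma pull_exact₂ {d₂ : E₃ ⟶ E₂} {d₁ : E₂ ⟶ E₁} {w : d₂ ≫ d₁ = 0}
    (h : (ShortComplex.mk d₂ d₁ w).Exact) (q : V ⟶ E₁) (w₀ : d₂ ≫ d₁ = 0 ≫ q)
    (w' : pullback.lift d₂ 0 w₀ ≫ pullback.snd d₁ q = 0) :
    (ShortComplex.mk (pullback.lift d₂ 0 w₀) (pullback.snd d₁ q) w').Exact := by
  refine exact_of_refine _ fun x hx => ?_
  obtain ⟨T', π, hπ, y, hy⟩ := exact_refine h (x ≫ pullback.fst d₁ q) (by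
    rw [Category.assoc, pullback.condition, ← Category.assoc, hx, zero_comp])
  refine ⟨T', π, hπ, y, ?_⟩
  apply pullback.hom_ext
  · rw [Category.assoc, Category.assoc, hy, plift_fst]
  · rw [Category.assoc, Category.assoc, hx, plift_snd, comp_zero, comp_zero]

lemma pull_exact₃ {d₃ : E₄ ⟶ E₃} {d₂ : E₃ ⟶ E₂} {d₁ : E₂ ⟶ E₁} {w : d₃ ≫ d₂ = 0}
    (h : (ShortComplex.mk d₃ d₂ w).Exact) (q : V ⟶ E₁) (w₀ : d₂ ≫ d₁ = 0 ≫ q)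
    (w' : d₃ ≫ pullback.lift d₂ 0 w₀ = 0) :
    (ShortComplex.mk d₃ (pullback.lift d₂ 0 w₀) w').Exact := by
  refine exact_of_refine _ fun x hx => ?_
  refine exact_refine h x ?_
  have := congrArg (· ≫ pullback.fst d₁ q) hx
  rwa [Category.assoc, plift_fst, zero_comp] at this

end Refine

namespace ExtSeq

variable {n : ℕ} {X Y : A}

noncomputable def pullOb (s : ExtSeq A n X Y) {V : A} (q : V ⟶ s.ob 1) : ℕ → A
  | 0 => s.ob 0
  | 1 => V
  | 2 => pullback (s.d 1) q
  | i + 3 => s.ob (i + 3)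

lemma pull_w (s : ExtSeq A n X Y) {V : A} (q : V ⟶ s.ob 1) :
    s.d 2 ≫ s.d 1 = 0 ≫ q := by rw [s.w 1, zero_comp]

noncomputable def pullD (s : ExtSeq A n X Y) {V : A} (q : V ⟶ s.ob 1) :
    ∀ i, s.pullOb q (i + 1) ⟶ s.pullOb q i
  | 0 => q ≫ s.d 0
  | 1 => pullback.snd (s.d 1) q
  | 2 => pullback.lift (s.d 2) 0 (s.pull_w q)
  | i + 3 => s.d (i + 3)

/-- Pull back an extension along an epimorphism to its rightmost middle term. -/
noncomputable def pull (s : ExtSeq A (n + 2) X Y) {V : A} (q : V ⟶ s.ob 1) [Epi q] :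
    ExtSeq A (n + 2) X Y where
  ob := s.pullOb q
  d := s.pullD q
  iso0 := s.iso0
  isoTop := s.isoTop
  is_zero := by
    rintro (_ | _ | _ | i) hi
    · omega
    · omega
    · omega
    · exact s.is_zero _ hi
  w := by
    rintro (_ | _ | _ | i)
    · change pullback.snd (s.d 1) q ≫ q ≫ s.d 0 = 0
      rw [← Category.assoc, ← pullback.condition, Category.assoc, s.w 0, comp_zero]
    · change pullback.lift (s.d 2) 0 (s.pull_w q) ≫ pullback.snd (s.d 1) q = 0
      rw [plift_snd]
    · change s.d 3 ≫ pullback.lift (s.d 2) 0 (s.pull_w q) = 0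
      apply pullback.hom_ext
      · rw [Category.assoc, plift_fst, s.w 2, zero_comp]
      · rw [Category.assoc, plift_snd, comp_zero, zero_comp]
    · exact s.w _
  ex := by
    rintro (_ | _ | _ | i)
    · exact pull_exact₁ (s.ex 0) q _
    · exact pull_exact₂ (s.ex 1) q (s.pull_w q) _
    · exact pull_exact₃ (s.ex 2) q (s.pull_w q) _
    · exact s.ex _
  epi0 := by
    have := s.epi0
    change Epi (q ≫ s.d 0)
    infer_instance

noncomputable def pullHom (s : ExtSeq A (n + 2) X Y) {V : A} (q : V ⟶ s.ob 1) [Epi q] :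
    GHom (s.pull q) s (𝟙 X) where
  φ
    | 0 => 𝟙 _
    | 1 => q
    | 2 => pullback.fst (s.d 1) q
    | i + 3 => 𝟙 _
  comm := by
    rintro (_ | _ | _ | i)
    · exact Category.comp_id _
    · exact pullback.condition.symm
    · change pullback.lift (s.d 2) 0 (s.pull_w q) ≫ pullback.fst (s.d 1) q = 𝟙 _ ≫ s.d 2
      rw [plift_fst, Category.id_comp]
    · change s.d _ ≫ 𝟙 _ = 𝟙 _ ≫ s.d _
      simp
  φ0 := by
    change 𝟙 _ ≫ s.iso0.hom = s.iso0.hom ≫ 𝟙 _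
    simp
  φTop := Category.id_comp _

/-- A morphism of extensions of the kernel gives a morphism of spliced extensions. -/
noncomputable def spliceHomId {S : ShortComplex A} (hS : S.ShortExact)
    {t t' : ExtSeq A n S.X₁ Y} (g : GHom t t' (𝟙 S.X₁)) :
    GHom (splice hS t) (splice hS t') (𝟙 S.X₃) :=
  spliceHom hS hS (𝟙 S) g

lemma stage_one {𝒰 : Set A} (hgen : ∀ X : A, ∃ U ∈ 𝒰, ∃ f : U ⟶ X, Epi f) (n : ℕ) :
    ∀ (X : A) (s : ExtSeq A (n + 1) X Y), ∃ t : ExtSeq A (n + 1) X Y,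
      (∀ i, 1 ≤ i → i < n + 1 → t.ob i ∈ 𝒰) ∧ Nonempty (GHom t s (𝟙 X)) := by
  induction n with
  | zero => exact fun X s => ⟨s, fun i h1 h2 => by omega, ⟨GHom.ofHom
      { φ := fun _ => 𝟙 _, comm := by simp, φ0 := by simp, φTop := by simp }⟩⟩
  | succ n ih =>
    intro X s
    obtain ⟨V, hV, q, hq⟩ := hgen (s.ob 1)
    obtain ⟨t', ht', ⟨g⟩⟩ := ih _ (s.pull q).tail
    refine ⟨splice (s.pull q).rightSC_shortExact t', ?_, ⟨?_⟩⟩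
    · rintro (_ | _ | i) h1 h2
      · omega
      · exact hV
      · exact ht' (i + 1) (by omega) (by omega)
    · have h := ((spliceHomId (s.pull q).rightSC_shortExact g).comp (s.pull q).fromSplice).comp
        (s.pullHom q)
      simpa using h

end ExtSeq

/-! ### Pushing the coresolution to the right -/

section Push

variable {E₄ E₃ E₂ E₁ E₀ W : A}

lemma push_exact₁ {d₁ : E₂ ⟶ E₁} {d₀ : E₁ ⟶ E₀} {w : d₁ ≫ d₀ = 0}
    (h : (ShortComplex.mk d₁ d₀ w).Exact) (f : E₂ ⟶ W) (e : W ⟶ E₁) (he : f ≫ e = d₁)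
    (k : cokernel f ⟶ E₀) (hk : cokernel.π f ≫ k = -(e ≫ d₀))
    (w' : biprod.lift e (cokernel.π f) ≫ biprod.desc d₀ k = 0) :
    (ShortComplex.mk (biprod.lift e (cokernel.π f)) (biprod.desc d₀ k) w').Exact := by
  refine exact_of_refine _ fun x hx => ?_
  have hx' : x ≫ biprod.fst ≫ d₀ + x ≫ biprod.snd ≫ k = 0 := by
    rw [biprod.desc_eq, Preadditive.comp_add] at hx
    exact hx
  obtain ⟨T₁, π₁, hπ₁, y, hy⟩ :=
    surjective_up_to_refinements_of_epi (cokernel.π f) (x ≫ biprod.snd)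
  obtain ⟨T₂, π₂, hπ₂, z, hz⟩ := exact_refine h (π₁ ≫ x ≫ biprod.fst - y ≫ e) (by
    have h1 : (y ≫ e) ≫ d₀ = -(π₁ ≫ x ≫ biprod.snd ≫ k) := by
      have := congrArg (· ≫ k) hy
      simp only [Category.assoc, hk, Preadditive.comp_neg] at this
      rw [this, Category.assoc, neg_neg]
    have h2 : x ≫ biprod.fst ≫ d₀ = -(x ≫ biprod.snd ≫ k) := eq_neg_of_add_eq_zero_left hx'
    rw [Preadditive.sub_comp, h1, Category.assoc, Category.assoc, h2]
    simp)
  refine ⟨T₂, π₂ ≫ π₁, inferInstance, π₂ ≫ y + z ≫ f, ?_⟩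
  apply biprod.hom_ext
  · simp only [Category.assoc, biprod.lift_fst, Preadditive.add_comp, he]
    rw [← hz]
    simp
  · simp only [Category.assoc, biprod.lift_snd, Preadditive.add_comp, cokernel.condition,
      comp_zero, add_zero]
    rw [hy]

lemma push_exact₂ {d₂ : E₃ ⟶ E₂} {d₁ : E₂ ⟶ E₁} {w : d₂ ≫ d₁ = 0}
    (h : (ShortComplex.mk d₂ d₁ w).Exact) (f : E₂ ⟶ W) [Mono f] (e : W ⟶ E₁)
    (he : f ≫ e = d₁) (w' : (d₂ ≫ f) ≫ biprod.lift e (cokernel.π f) = 0) :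
    (ShortComplex.mk (d₂ ≫ f) (biprod.lift e (cokernel.π f)) w').Exact := by
  refine exact_of_refine _ fun x hx => ?_
  have h1 : x ≫ e = 0 := by simpa using congrArg (· ≫ biprod.fst) hx
  have h2 : x ≫ cokernel.π f = 0 := by simpa using congrArg (· ≫ biprod.snd) hx
  obtain ⟨T₁, π₁, hπ₁, y, hy⟩ := exact_refine (ShortComplex.exact_cokernel f) x h2
  obtain ⟨T₂, π₂, hπ₂, z, hz⟩ := exact_refine h y (by
    rw [← he, ← Category.assoc, ← hy, Category.assoc, h1, comp_zero])
  refine ⟨T₂, π₂ ≫ π₁, inferInstance, z, ?_⟩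
  rw [Category.assoc, hy, ← Category.assoc, hz, Category.assoc]

end Push

namespace ExtSeq

variable {n : ℕ} {X Y : A}

noncomputable def pushOb (s : ExtSeq A n X Y) {W : A} (f : s.ob 2 ⟶ W) : ℕ → A
  | 0 => s.ob 0
  | 1 => s.ob 1 ⊞ cokernel f
  | 2 => W
  | i + 3 => s.ob (i + 3)

noncomputable def pushK (s : ExtSeq A n X Y) {W : A} (f : s.ob 2 ⟶ W) (e : W ⟶ s.ob 1)
    (he : f ≫ e = s.d 1) : cokernel f ⟶ s.ob 0 :=
  cokernel.desc f (-(e ≫ s.d 0)) (by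
    rw [Preadditive.comp_neg, ← Category.assoc, he, s.w 0, neg_zero])

lemma π_pushK (s : ExtSeq A n X Y) {W : A} (f : s.ob 2 ⟶ W) (e : W ⟶ s.ob 1)
    (he : f ≫ e = s.d 1) : cokernel.π f ≫ s.pushK f e he = -(e ≫ s.d 0) :=
  cokernel.π_desc _ _ _

noncomputable def pushD (s : ExtSeq A n X Y) {W : A} (f : s.ob 2 ⟶ W) (e : W ⟶ s.ob 1)
    (he : f ≫ e = s.d 1) : ∀ i, s.pushOb f (i + 1) ⟶ s.pushOb f i
  | 0 => biprod.desc (s.d 0) (s.pushK f e he)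
  | 1 => biprod.lift e (cokernel.π f)
  | 2 => s.d 2 ≫ f
  | i + 3 => s.d (i + 3)

/-- Replace the second middle term by `W`, changing the first one by the cokernel. -/
noncomputable def push (s : ExtSeq A (n + 2) X Y) {W : A} (f : s.ob 2 ⟶ W) [Mono f]
    (e : W ⟶ s.ob 1) (he : f ≫ e = s.d 1) : ExtSeq A (n + 2) X Y where
  ob := s.pushOb f
  d := s.pushD f e he
  iso0 := s.iso0
  isoTop := s.isoTop
  is_zero := by
    rintro (_ | _ | _ | i) hi
    · omega
    · omega
    · omega
    · exact s.is_zero _ hi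
  w := by
    rintro (_ | _ | _ | i)
    · change biprod.lift e (cokernel.π f) ≫ biprod.desc (s.d 0) (s.pushK f e he) = 0
      rw [biprod.lift_desc, π_pushK, add_neg_cancel]
    · change (s.d 2 ≫ f) ≫ biprod.lift e (cokernel.π f) = 0
      apply biprod.hom_ext
      · simp [he, s.w 1]
      · simp
    · change s.d 3 ≫ s.d 2 ≫ f = 0
      rw [← Category.assoc, s.w 2, zero_comp]
    · exact s.w _
  ex := by
    rintro (_ | _ | _ | i)
    · exact push_exact₁ (s.ex 0) f e he _ (s.π_pushK f e he) _
    · exact push_exact₂ (s.ex 1) f e he _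
    · exact (ex_mono_iff (s.d 3) (s.d 2) f (s.w 2) _).2 (s.ex 2)
    · exact s.ex _
  epi0 := by
    have := s.epi0
    change Epi (biprod.desc (s.d 0) (s.pushK f e he))
    exact epi_of_epi_fac (biprod.inl_desc (s.d 0) (s.pushK f e he))

noncomputable def pushHom (s : ExtSeq A (n + 2) X Y) {W : A} (f : s.ob 2 ⟶ W) [Mono f]
    (e : W ⟶ s.ob 1) (he : f ≫ e = s.d 1) : GHom s (s.push f e he) (𝟙 X) where
  φ
    | 0 => 𝟙 _
    | 1 => biprod.inl
    | 2 => f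
    | i + 3 => 𝟙 _
  comm := by
    rintro (_ | _ | _ | i)
    · change s.d 0 ≫ 𝟙 _ = biprod.inl ≫ biprod.desc (s.d 0) (s.pushK f e he)
      simp
    · change s.d 1 ≫ biprod.inl = f ≫ biprod.lift e (cokernel.π f)
      apply biprod.hom_ext
      · simp [he]
      · simp
    · exact (Category.id_comp (s.d 2 ≫ f)).symm
    · change s.d _ ≫ 𝟙 _ = 𝟙 _ ≫ s.d _
      simp
  φ0 := by
    change 𝟙 _ ≫ s.iso0.hom = s.iso0.hom ≫ 𝟙 _
    simp
  φTop := Category.id_comp _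

lemma stage_two {d : ℕ} {𝒰 : Set A}
    (hUadd : ∀ X Y : A, X ∈ 𝒰 → Y ∈ 𝒰 → (X ⊞ Y) ∈ 𝒰)
    (hrigid : ∀ i, 0 < i → i < d → ∀ U ∈ 𝒰, ∀ U' ∈ 𝒰, extVanish A i U U') (n : ℕ) :
    ∀ (c : ℕ) (X : A) (s : ExtSeq A (n + 1) X Y),
      (∀ i, 1 ≤ i → i < n + 1 → s.ob i ∈ 𝒰) → s.ob (n + 1) ∈ coresSet A 𝒰 (n + 1 + c) →
      n + 1 + c ≤ d → ∃ t : ExtSeq A (n + 1) X Y,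
      (∀ i, 2 ≤ i → i ≤ n + 1 → t.ob i ∈ 𝒰) ∧ t.ob 1 ∈ coresSet A 𝒰 (c + 1) ∧
        Nonempty (GHom s t (𝟙 X)) := by
  induction n with
  | zero =>
    intro c X s _ hs _
    refine ⟨s, fun i h1 h2 => by omega, ?_, ⟨GHom.ofHom
      { φ := fun _ => 𝟙 _, comm := by simp, φ0 := by simp, φTop := by simp }⟩⟩
    rw [add_comm c 1]
    exact hs
  | succ n ih =>
    intro c X s h1 h2 h3
    obtain ⟨t', ht', hc', ⟨g⟩⟩ := ih (c + 1) _ s.tail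
      (by
        rintro (_ | i) hi hi'
        · omega
        · exact h1 (i + 2) (by omega) (by omega))
      (by
        have : n + 1 + (c + 1) = n + 1 + 1 + c := by omega
        rw [this]
        exact h2)
      (by omega)
    obtain ⟨W, f, hW, hf, hC⟩ := hc'
    let r := splice s.rightSC_shortExact t'
    have hE : s.ob 1 ∈ 𝒰 := h1 1 le_rfl (by omega)
    obtain ⟨e, he⟩ := cores_extend hrigid hE (c + 1) f hC (by omega)
      (r.d 1 : t'.ob 1 ⟶ s.ob 1)
    let f' : r.ob 2 ⟶ W := f
    let e' : W ⟶ r.ob 1 := e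
    have hf' : Mono f' := hf
    have he' : f' ≫ e' = r.d 1 := he
    refine ⟨r.push f' e' he', ?_, ?_, ⟨?_⟩⟩
    · rintro (_ | _ | _ | i) hi hi'
      · omega
      · omega
      · exact hW
      · exact ht' (i + 2) (by omega) (by omega)
    · exact coresSet_biprod hUadd hE hC
    · have h := (s.toSplice.comp (spliceHomId s.rightSC_shortExact g)).comp
        (r.pushHom f' e' he')
      simpa using h

end ExtSeq

/-- a generating, weakly right maximal `d`-rigid subcategory is closed
under `d`-extensions. -/
theorem generating_weakly_right_maximal_d_rigid_dExtClosed
    (A : Type u) [Category.{v} A] [Abelian A] (d : ℕ) (hd : 1 ≤ d)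
    (𝒰 : Set A)
    (hU0 : ∀ Z : A, IsZero Z → Z ∈ 𝒰)
    (hUadd : ∀ X Y : A, X ∈ 𝒰 → Y ∈ 𝒰 → (X ⊞ Y) ∈ 𝒰)
    (hUiso : ∀ X Y : A, (X ≅ Y) → X ∈ 𝒰 → Y ∈ 𝒰)
    (hrigid : ∀ i, 0 < i → i < d → ∀ U ∈ 𝒰, ∀ U' ∈ 𝒰, extVanish A i U U')
    (hgen : ∀ X : A, ∃ U ∈ 𝒰, ∃ f : U ⟶ X, Epi f)
    (hmax : ∀ E : A, E ∈ coresSet A 𝒰 d) :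
    DExtClosed A 𝒰 d := by

  intro X Y _ _ s
  obtain ⟨n, rfl⟩ : ∃ n, d = n + 1 := ⟨d - 1, by omega⟩
  obtain ⟨s', hs', ⟨g⟩⟩ := ExtSeq.stage_one hgen n X s
  obtain ⟨t, ht, ht1, ⟨g'⟩⟩ := ExtSeq.stage_two hUadd hrigid n 0 X s' hs' (hmax _) le_rfl
  refine ⟨t, ?_, ?_⟩
  · intro i h1 h2
    rcases Nat.lt_or_ge i 2 with h | h
    · obtain rfl : i = 1 := by omega
      exact mem_of_coresSet_one hUiso ht1
    · exact ht i h h2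
  · exact Relation.EqvGen.trans _ s' _ (Relation.EqvGen.symm _ _ (Relation.EqvGen.rel _ _ ⟨g.toHom⟩))
      (Relation.EqvGen.rel _ _ ⟨g'.toHom⟩)
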